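/- (Lemma B.2, discounted case.) Under hypotheses (i)–(iv) of the discounted inexact anchored iteration, setting ρ_j = 2·‖Q^0 − Q^*‖_∞ + (1/3)·ε·j, for all 1 ≤ k ≤ n one has ‖Q^k − Q^{k−1}‖_∞ ≤ (2/(k(k+1)))·∑_{i=1}^{k} ρ_{i+2}. -/

import Mathlib

open Finset

/-- Sup norm `‖x‖_∞ = max_j |x j|` on a nonempty finite index set. -/
noncomputable def supNorm {J : Type*} [Fintype J] [Nonempty J] (x : J → ℝ) : ℝ :=
  univ.sup' univ_nonempty (fun j => |x j|)

/-- `P` is a transition kernel: nonnegative entries, each row sums to one. -/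
def IsKernel {S A : Type*} [Fintype S] (P : S → A → S → ℝ) : Prop :=
  (∀ s a s', 0 ≤ P s a s') ∧ (∀ s a, ∑ s', P s a s' = 1)

/-- The discounted Bellman operator
`𝒯_γ(Q)(s,a) = r(s,a) + γ·∑_{s'} P(s'|s,a)·max_{a'} Q(s',a')`. -/
noncomputable def bellmanD {S A : Type*} [Fintype S] [Fintype A] [Nonempty A]
    (γ : ℝ) (P : S → A → S → ℝ) (r : S → A → ℝ) (Q : S × A → ℝ) : S × A → ℝ :=
  fun p => r p.1 p.2 +
    γ * ∑ s', P p.1 p.2 s' * (univ.sup' univ_nonempty (fun a' => Q (s', a')))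

/-- The anchoring coefficients `β_k = k/(k+2)`. -/
noncomputable def beta (k : ℕ) : ℝ := (k : ℝ) / ((k : ℝ) + 2)

theorem abs_le_supNorm {J : Type*} [Fintype J] [Nonempty J] (x : J → ℝ) (j : J) :
    |x j| ≤ supNorm x :=
  Finset.le_sup' (fun j => |x j|) (mem_univ j)

theorem supNorm_le {J : Type*} [Fintype J] [Nonempty J] {x : J → ℝ} {c : ℝ}
    (h : ∀ j, |x j| ≤ c) : supNorm x ≤ c :=
  Finset.sup'_le _ _ fun j _ => h j

theorem supNorm_nonneg {J : Type*} [Fintype J] [Nonempty J] (x : J → ℝ) : 0 ≤ supNorm x :=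
  (abs_nonneg _).trans (abs_le_supNorm x (Classical.arbitrary J))

theorem sup'_univ_le_add {A : Type*} [Fintype A] [Nonempty A] {f g : A → ℝ} {c : ℝ}
    (h : ∀ a, f a ≤ g a + c) :
    univ.sup' univ_nonempty f ≤ univ.sup' univ_nonempty g + c :=
  Finset.sup'_le _ _ fun a ha =>
    (h a).trans (add_le_add_left (Finset.le_sup' g ha) c)

/-- The discounted Bellman operator is a `γ`-contraction in the sup norm. -/
theorem abs_bellmanD_sub_le {S A : Type*} [Fintype S] [Nonempty S] [Fintype A] [Nonempty A]
    {γ : ℝ} (hγ : 0 ≤ γ) {P : S → A → S → ℝ} (hP : IsKernel P) (r : S → A → ℝ)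
    (Q Q' : S × A → ℝ) (p : S × A) :
    |bellmanD γ P r Q p - bellmanD γ P r Q' p| ≤ γ * supNorm (fun p => Q p - Q' p) := by
  set c := supNorm (fun p => Q p - Q' p) with hc
  have hQ : ∀ q, |Q q - Q' q| ≤ c := abs_le_supNorm (fun p => Q p - Q' p)
  have key : ∀ F G : S × A → ℝ, (∀ q, F q ≤ G q + c) →
      ∑ s', P p.1 p.2 s' * (univ.sup' univ_nonempty (fun a' => F (s', a'))) ≤
        ∑ s', P p.1 p.2 s' * (univ.sup' univ_nonempty (fun a' => G (s', a'))) + c := by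
    intro F G h
    calc _ ≤ ∑ s', P p.1 p.2 s' * (univ.sup' univ_nonempty (fun a' => G (s', a')) + c) :=
          Finset.sum_le_sum fun s' _ => mul_le_mul_of_nonneg_left
            (sup'_univ_le_add fun a => h (s', a)) (hP.1 _ _ _)
      _ = _ := by simp only [mul_add, Finset.sum_add_distrib, ← Finset.sum_mul, hP.2, one_mul]
  have h1 := mul_le_mul_of_nonneg_left
    (key Q Q' fun q => by linarith [(abs_le.1 (hQ q)).2]) hγ
  have h2 := mul_le_mul_of_nonneg_left
    (key Q' Q fun q => by linarith [(abs_le.1 (hQ q)).1]) hγ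
  rw [mul_add] at h1 h2
  unfold bellmanD
  rw [abs_le]
  constructor <;> linarith

/-- Lemma B.2 (discounted case): under hypotheses (i)–(iv), with
`ρ_j = 2·‖Q^0 − Q^*‖_∞ + (1/3)·ε·j`, one has
`‖Q^k − Q^{k−1}‖_∞ ≤ (2/(k(k+1)))·∑_{i=1}^{k} ρ_{i+2}` for all `1 ≤ k ≤ n`. -/
theorem savid_lemma_B2

    {S A : Type*} [Fintype S] [Nonempty S] [Fintype A] [Nonempty A]
    (γ : ℝ) (hγ0 : 0 < γ) (hγ1 : γ < 1)
    (P : S → A → S → ℝ) (hP : IsKernel P) (r : S → A → ℝ)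
    (ε : ℝ) (hε : 0 ≤ ε) (n : ℕ)
    (Q T : ℕ → S × A → ℝ) (Qstar : S × A → ℝ)
    (h1 : ∀ k, 1 ≤ k → k ≤ n →
      Q k = fun p => (1 - beta k) * Q 0 p + beta k * T (k - 1) p)
    (h2 : ∀ k, k ≤ n → supNorm (fun p => T k p - bellmanD γ P r (Q k) p) ≤ ε)
    (h3 : Qstar = bellmanD γ P r Qstar)
    (h4 : ∀ k, 1 ≤ k → k ≤ n →
      supNorm (fun p => T k p - T (k - 1) p) ≤ γ * supNorm (fun p => Q k p - Q (k - 1) p))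
    :
    ∀ k, 1 ≤ k → k ≤ n → supNorm (fun p => Q k p - Q (k - 1) p)
      ≤ (2 / ((k : ℝ) * ((k : ℝ) + 1))) *
        ∑ i ∈ Finset.Icc 1 k,
          (2 * supNorm (fun p => Q 0 p - Qstar p) + (1 / 3) * ε * ((i : ℝ) + 2)) := by
  set D := supNorm (fun p => Q 0 p - Qstar p) with hD
  have hDp : ∀ p, |Q 0 p - Qstar p| ≤ D := abs_le_supNorm (fun p => Q 0 p - Qstar p)
  have hT : ∀ k ≤ n, ∀ c, supNorm (fun p => Q k p - Qstar p) ≤ c →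
      ∀ p, |T k p - Qstar p| ≤ ε + c := by
    intro k hk c hc p
    have hb := abs_bellmanD_sub_le hγ0.le hP r (Q k) Qstar p
    rw [← h3] at hb
    have hγc := mul_le_of_le_one_left (supNorm_nonneg (fun p => Q k p - Qstar p)) hγ1.le
    have ht := (abs_le_supNorm (fun p => T k p - bellmanD γ P r (Q k) p) p).trans (h2 k hk)
    have htri := abs_sub_le (T k p) (bellmanD γ P r (Q k) p) (Qstar p)
    linarith
  have hE : ∀ k ≤ n, supNorm (fun p => Q k p - Qstar p) ≤ D + k / 3 * ε := by
    intro k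
    induction k with
    | zero => intro _; simp [hD]
    | succ k ih =>
      intro hk
      refine supNorm_le fun p => ?_
      have ht := hT k (by omega) _ (ih (by omega)) p
      have hβ0 : 0 ≤ beta (k + 1) := by unfold beta; positivity
      have hβ1 : 0 ≤ 1 - beta (k + 1) := by
        unfold beta
        rw [sub_nonneg, div_le_one (by positivity)]
        linarith
      have hrw : Q (k + 1) p - Qstar p = (1 - beta (k + 1)) * (Q 0 p - Qstar p)
          + beta (k + 1) * (T k p - Qstar p) := by
        rw [h1 (k + 1) (by omega) hk, Nat.add_sub_cancel]
        ring
      rw [hrw]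
      calc _ ≤ (1 - beta (k + 1)) * |Q 0 p - Qstar p|
            + beta (k + 1) * |T k p - Qstar p| := by
            refine (abs_add_le _ _).trans_eq ?_
            rw [abs_mul, abs_mul, abs_of_nonneg hβ0, abs_of_nonneg hβ1]
        _ ≤ (1 - beta (k + 1)) * D + beta (k + 1) * (ε + (D + k / 3 * ε)) := by
            gcongr
            exact hDp p
        _ = _ := by
            unfold beta
            push_cast
            field_simp
            ring
  have hTQ : ∀ k ≤ n, ∀ p, |T k p - Q 0 p| ≤ 2 * D + 1 / 3 * ε * ((k : ℝ) + 3) := by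
    intro k hk p
    have ht := hT k hk _ (hE k hk) p
    have htri := abs_sub_le (T k p) (Qstar p) (Q 0 p)
    rw [abs_sub_comm (Qstar p)] at htri
    linarith [hDp p]
  intro k hk
  induction k, hk using Nat.le_induction with
  | base =>
    intro hn
    refine supNorm_le fun p => ?_
    have hrw : Q 1 p - Q (1 - 1) p = 1 / 3 * (T 0 p - Q 0 p) := by
      rw [h1 1 le_rfl hn]
      simp only [beta, Nat.sub_self]
      norm_num
      ring
    have ht := hTQ 0 (by omega) p
    rw [hrw, abs_mul, abs_of_pos (by norm_num : (0 : ℝ) < 1 / 3)]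
    norm_num at ht ⊢
    linarith [abs_nonneg (T 0 p - Q 0 p)]
  | succ k hk ih =>
    intro hn
    have hd := ih (by omega)
    have h0 : (0 : ℝ) < k := by exact_mod_cast hk
    rw [Finset.sum_Icc_succ_top (by omega)]
    set R := ∑ i ∈ Finset.Icc 1 k, (2 * D + (1 / 3) * ε * ((i : ℝ) + 2))
    set d := supNorm (fun p => Q k p - Q (k - 1) p)
    have hd0 : 0 ≤ d := supNorm_nonneg _
    refine supNorm_le fun p => ?_
    have ht := hTQ k (by omega) p
    have hTT : |T k p - T (k - 1) p| ≤ d :=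
      ((abs_le_supNorm (fun p => T k p - T (k - 1) p) p).trans (h4 k hk (by omega))).trans
        (mul_le_of_le_one_left hd0 hγ1.le)
    have hrw : Q (k + 1) p - Q (k + 1 - 1) p =
        2 / (((k : ℝ) + 2) * (k + 3)) * (T k p - Q 0 p)
          + k / ((k : ℝ) + 2) * (T k p - T (k - 1) p) := by
      rw [Nat.add_sub_cancel, h1 (k + 1) (by omega) hn, h1 k hk (by omega)]
      simp only [beta, Nat.add_sub_cancel]
      push_cast
      field_simp
      ring
    rw [hrw]
    calc _ ≤ 2 / (((k : ℝ) + 2) * (k + 3)) * |T k p - Q 0 p|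
          + k / ((k : ℝ) + 2) * |T k p - T (k - 1) p| := by
          refine (abs_add_le _ _).trans_eq ?_
          rw [abs_mul, abs_mul,
            abs_of_nonneg (by positivity : 0 ≤ 2 / (((k : ℝ) + 2) * (k + 3))),
            abs_of_nonneg (by positivity : 0 ≤ (k : ℝ) / ((k : ℝ) + 2))]
      _ ≤ 2 / (((k : ℝ) + 2) * (k + 1)) * (2 * D + 1 / 3 * ε * ((k : ℝ) + 3))
          + k / ((k : ℝ) + 2) * (2 / ((k : ℝ) * ((k : ℝ) + 1)) * R) := by
          gcongr
          · norm_num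
          · exact hTT.trans hd
      _ = _ := by
          push_cast
          field_simp
          ring
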